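/- Let R be a quasi-Frobenius ring. Then qgldim(R) = 0 or qgldim(R) = ∞. Moreover, if qgldim(R) = 0, then every finitely generated left R-module M with Ext_R^i(M, M) = 0 for all integers i ≥ 2 is projective. -/

import Mathlib

/-!
Quasi-projective dimension, following Gheibi–Jorgensen–Takahashi and
Chen–Chen–Liu, "Properties of quasi-projective dimension over abelian categories".
-/

open CategoryTheory CategoryTheory.Limits

attribute [local instance] CategoryTheory.Abelian.hasFiniteBiproducts

noncomputable section

universe v u

namespace QPD

variable {A : Type*} [Category A] [Abelian A]

/-- The direct sum of `n` copies of `M`. -/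
def copies (M : A) (n : ℕ) : A := ⨁ (fun _ : Fin n => M)

/-- `X` belongs to `add M`: it is a direct summand of a finite direct sum of copies of `M`. -/
def inAdd (M X : A) : Prop :=
  ∃ (n : ℕ) (s : X ⟶ copies M n) (r : copies M n ⟶ X), s ≫ r = 𝟙 X

/-- `P` is a quasi-projective resolution of `M`: a bounded-below complex of projective
objects whose `j`-th homology is a direct sum of `mult j` copies of `M`, where the
multiplicities `mult j` are not all zero. -/
structure IsQuasiProjRes (M : A) (P : ChainComplex A ℤ) : Prop where
  projective : ∀ i, Projective (P.X i)
  bddBelow : ∃ a : ℤ, ∀ i, i < a → IsZero (P.X i)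
  homology_iso : ∃ mult : ℤ → ℕ, (∃ j, mult j ≠ 0) ∧
    ∀ j, Nonempty (P.homology j ≅ copies M (mult j))

/-- `P` is a finite (i.e. bounded) quasi-projective resolution of `M`. -/
structure IsFiniteQuasiProjRes (M : A) (P : ChainComplex A ℤ) extends
    IsQuasiProjRes M P : Prop where
  bddAbove : ∃ b : ℤ, ∀ i, b < i → IsZero (P.X i)

/-- `s` is the supremum of the degrees in which `P` is nonzero. -/
def IsSup (P : ChainComplex A ℤ) (s : ℤ) : Prop :=
  ¬ IsZero (P.X s) ∧ ∀ i, s < i → IsZero (P.X i)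

/-- `t` is the supremum of the degrees in which the homology of `P` is nonzero. -/
def IsHSup (P : ChainComplex A ℤ) (t : ℤ) : Prop :=
  ¬ IsZero (P.homology t) ∧ ∀ i, t < i → IsZero (P.homology i)

/-- `t` is the infimum of the degrees in which the homology of `P` is nonzero. -/
def IsHInf (P : ChainComplex A ℤ) (t : ℤ) : Prop :=
  ¬ IsZero (P.homology t) ∧ ∀ i, i < t → IsZero (P.homology i)

open Classical in
/-- The quasi-projective dimension of `M`, as an element of `ℕ∞`: the infimum of
`sup P• - hsup P•` over all finite quasi-projective resolutions `P•` of `M`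
(it is `0` for the zero object and `⊤` if no finite quasi-projective resolution exists). -/
def qpd (M : A) : ℕ∞ :=
  if IsZero M then 0
  else sInf {d : ℕ∞ | ∃ (P : ChainComplex A ℤ) (s t : ℤ),
    IsFiniteQuasiProjRes M P ∧ IsSup P s ∧ IsHSup P t ∧ d = ((s - t).toNat : ℕ∞)}

/-- `M` admits a projective resolution of length at most `n`. -/
def pdLE (M : A) (n : ℕ) : Prop :=
  ∃ P : ChainComplex A ℤ, (∀ i, Projective (P.X i)) ∧
    (∀ i : ℤ, i < 0 → IsZero (P.X i)) ∧ (∀ i : ℤ, (n : ℤ) < i → IsZero (P.X i)) ∧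
    (∀ i : ℤ, i ≠ 0 → IsZero (P.homology i)) ∧ Nonempty (P.homology 0 ≅ M)

/-- The projective dimension of `M`, as an element of `ℕ∞`. -/
def pd (M : A) : ℕ∞ := sInf {d : ℕ∞ | ∃ n : ℕ, d = (n : ℕ∞) ∧ pdLE M n}

open Classical in
/-- Quasi-projective dimension computed using only complexes all of whose terms satisfy the
predicate `Q` (e.g. `Q` = "finitely generated", for the category of finitely presented
modules over a left coherent ring). -/
def qpdRel (Q : A → Prop) (M : A) : ℕ∞ :=
  if IsZero M then 0
  else sInf {d : ℕ∞ | ∃ (P : ChainComplex A ℤ) (s t : ℤ),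
    IsFiniteQuasiProjRes M P ∧ (∀ i, Q (P.X i)) ∧ IsSup P s ∧ IsHSup P t ∧
    d = ((s - t).toNat : ℕ∞)}

/-- Projective dimension computed using only resolutions all of whose terms satisfy the
predicate `Q`. -/
def pdRel (Q : A → Prop) (M : A) : ℕ∞ :=
  sInf {d : ℕ∞ | ∃ n : ℕ, d = (n : ℕ∞) ∧ ∃ P : ChainComplex A ℤ,
    (∀ i, Projective (P.X i)) ∧ (∀ i, Q (P.X i)) ∧
    (∀ i : ℤ, i < 0 → IsZero (P.X i)) ∧ (∀ i : ℤ, (n : ℤ) < i → IsZero (P.X i)) ∧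
    (∀ i : ℤ, i ≠ 0 → IsZero (P.homology i)) ∧ Nonempty (P.homology 0 ≅ M)}

/-- Vanishing of the `n`-th Ext group, `Ext_𝒜^n(M, N) = 0`. -/
def extIsZero [EnoughProjectives A] (M N : A) (n : ℕ) : Prop :=
  IsZero (((_root_.Ext ℤ A n).obj (Opposite.op M)).obj N)

/-- The quasi-projective dimension of a finitely presented module over a (left coherent)
ring, computed inside the abelian category of finitely presented modules, i.e. via bounded
complexes of finitely generated projective modules. -/
def qpdFG {R : Type u} [Ring R] (M : ModuleCat.{u} R) : ℕ∞ :=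
  qpdRel (fun N : ModuleCat.{u} R => Module.Finite R N) M

/-- The projective dimension of a finitely presented module over a (left coherent) ring,
computed inside the abelian category of finitely presented modules. -/
def pdFG {R : Type u} [Ring R] (M : ModuleCat.{u} R) : ℕ∞ :=
  pdRel (fun N : ModuleCat.{u} R => Module.Finite R N) M

/-- A ring is left coherent if every finitely generated left ideal is finitely presented. -/
def IsLeftCoherent (R : Type u) [Ring R] : Prop :=
  ∀ I : Ideal R, I.FG → Module.FinitePresentation R I

/-- The quasi-global dimension of a ring: the supremum of the quasi-projective dimensions
of all finitely generated left modules. -/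
def qgldim (R : Type u) [Ring R] : ℕ∞ :=
  sSup {d : ℕ∞ | ∃ M : ModuleCat.{u} R, Module.Finite R M ∧ d = qpd M}

/-- The global dimension of a ring: the supremum of the projective dimensions of all
finitely generated left modules. -/
def gldim (R : Type u) [Ring R] : ℕ∞ :=
  sSup {d : ℕ∞ | ∃ M : ModuleCat.{u} R, Module.Finite R M ∧ d = pd M}

/-- The finitistic dimension of a ring: the supremum of the projective dimensions of all
finitely generated left modules of finite projective dimension. -/
def findim (R : Type u) [Ring R] : ℕ∞ :=
  sSup {d : ℕ∞ | ∃ M : ModuleCat.{u} R, Module.Finite R M ∧ d = pd M ∧ pd M ≠ ⊤}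

/-- The depth of a module over a Noetherian local ring:
`depth M = inf {i : Ext^i(R/𝔪, M) ≠ 0}`. -/
def depth {R : Type u} [CommRing R] [IsLocalRing R] (M : ModuleCat.{u} R) : ℕ∞ :=
  sInf {d : ℕ∞ | ∃ n : ℕ, d = (n : ℕ∞) ∧
    ¬ IsZero (((_root_.Ext ℤ (ModuleCat.{u} R) n).obj
      (Opposite.op (ModuleCat.of R (IsLocalRing.ResidueField R)))).obj M)}

end QPD

end

noncomputable section

namespace QPD

open Abelian

universe w' v' u'

variable {C : Type u'} [Category.{v'} C] [Abelian C]

section Opcycles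

/-- If `P` is acyclic in degree `i + 1`, then `0 ⟶ opcycles (i + 1) ⟶ P.X i ⟶ opcycles i ⟶ 0`
is a short exact sequence. -/
lemma shortExact_opcycles (P : ChainComplex C ℤ) (i : ℤ) (hP : IsZero (P.homology (i + 1))) :
    (ShortComplex.mk (P.fromOpcycles (i + 1) i) (P.pOpcycles i)
      (by simp [← cancel_epi (P.pOpcycles (i + 1))])).ShortExact := by
  have hij : (ComplexShape.down ℤ).Rel (i + 1) i := rfl
  have hmono : Mono (P.fromOpcycles (i + 1) i) :=
    (ShortComplex.exact_of_f_is_kernel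
      (ShortComplex.mk _ _ (P.homologyι_comp_fromOpcycles (i + 1) i))
      (P.homologyIsKernel (i + 1) i (ComplexShape.next_eq' _ hij))).mono_g
        (hP.eq_of_src _ _)
  let S := ShortComplex.mk (P.d (i + 1) i) (P.pOpcycles i) (by simp)
  let T := ShortComplex.mk (P.fromOpcycles (i + 1) i) (P.pOpcycles i)
    (by simp [← cancel_epi (P.pOpcycles (i + 1))])
  let π : S ⟶ T := { τ₁ := P.pOpcycles (i + 1), τ₂ := 𝟙 _, τ₃ := 𝟙 _ }
  have hS : S.Exact :=
    S.exact_of_g_is_cokernel (P.opcyclesIsCokernel (i + 1) i (ComplexShape.prev_eq' _ hij))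
  exact
    { exact := (ShortComplex.exact_iff_of_epi_of_isIso_of_mono π).1 hS
      mono_f := hmono
      epi_g := inferInstanceAs (Epi (P.pOpcycles i)) }

/-- In a category where projective objects are injective, the opcycles of a bounded complex of
projectives are projective in all degrees above which the complex is acyclic. -/
lemma projective_opcycles (hproj : ∀ X : C, Projective X → Injective X)
    (P : ChainComplex C ℤ) (hP : ∀ i, Projective (P.X i))
    {b : ℤ} (hb : ∀ i, b < i → IsZero (P.X i)) {t : ℤ} (ht : ∀ i, t < i → IsZero (P.homology i))
    (i : ℤ) (hi : t ≤ i) : Projective (P.opcycles i) := by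
  have key : ∀ (n : ℕ) (i : ℤ), t ≤ i → b < i + n → Projective (P.opcycles i) := by
    intro n
    induction n with
    | zero =>
      intro i _ hbi
      exact ((hb i (by simpa using hbi)).of_epi (P.pOpcycles i)).projective
    | succ n ih =>
      intro i hti hbi
      have hS := shortExact_opcycles P i (ht _ (by lia))
      have : Injective (P.opcycles (i + 1)) :=
        hproj _ (ih (i + 1) (by lia) (by push_cast at hbi; lia))
      let σ := hS.splittingOfInjective
      have := hP i
      exact Retract.projective (Y := P.X i) ⟨σ.s, P.pOpcycles i, σ.s_g⟩
  exact key (b + 1 - i).toNat i hi (by lia)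

end Opcycles

section Truncation

/-- The embedding of complex shapes `n ↦ t - n`, with image the degrees at most `t`. -/
def embeddingDegreeLE (t : ℤ) : (ComplexShape.up ℕ).Embedding (ComplexShape.down ℤ) :=
  ComplexShape.Embedding.mk' _ _ (fun n => t - n) (fun a b h => by simpa using h)
    (fun a b => by simp only [ComplexShape.up_Rel, ComplexShape.down_Rel]; lia)

lemma embeddingDegreeLE_f (t : ℤ) (n : ℕ) : (embeddingDegreeLE t).f n = t - n := rfl

instance (t : ℤ) : (embeddingDegreeLE t).IsRelIff where
  rel' a b h := by
    simp only [embeddingDegreeLE_f, ComplexShape.up_Rel, ComplexShape.down_Rel] at h ⊢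
    lia

instance (t : ℤ) : (embeddingDegreeLE t).IsTruncGE where
  mem_next {j k} h := ⟨j + 1, by
    simp only [embeddingDegreeLE_f, ComplexShape.down_Rel] at h ⊢
    push_cast
    lia⟩

lemma boundaryGE_embeddingDegreeLE_zero (t : ℤ) : (embeddingDegreeLE t).BoundaryGE 0 :=
  (embeddingDegreeLE t).boundaryGE (i' := t + 1)
    (by simp [embeddingDegreeLE_f])
    (fun a => by rw [embeddingDegreeLE_f]; lia)

lemma not_boundaryGE_embeddingDegreeLE_succ (t : ℤ) (n : ℕ) :
    ¬ (embeddingDegreeLE t).BoundaryGE (n + 1) :=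
  (embeddingDegreeLE t).not_boundaryGE_next (j := n) rfl

variable (P : ChainComplex C ℤ) (t : ℤ)

/-- The truncation `P.opcycles t ⟶ P.X (t - 1) ⟶ ⋯` of a chain complex in degrees `≤ t`. -/
def truncDegreeLE : ChainComplex C ℤ := P.truncGE (embeddingDegreeLE t)

lemma isZero_truncDegreeLE_X {i : ℤ} (hi : t < i) : IsZero ((truncDegreeLE P t).X i) :=
  (P.truncGE (embeddingDegreeLE t)).isZero_X_of_isStrictlySupported (embeddingDegreeLE t) i
    (fun a => by rw [embeddingDegreeLE_f]; lia)

/-- In degree `t`, the truncation is the object of opcycles. -/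
def truncDegreeLEXIsoOpcycles : (truncDegreeLE P t).X t ≅ P.opcycles t :=
  P.truncGEXIsoOpcycles (embeddingDegreeLE t) (i := 0) (by simp [embeddingDegreeLE_f])
    (boundaryGE_embeddingDegreeLE_zero t)

/-- In degrees below `t`, the truncation agrees with the original complex. -/
def truncDegreeLEXIso {i : ℤ} (hi : i < t) : (truncDegreeLE P t).X i ≅ P.X i :=
  P.truncGEXIso (embeddingDegreeLE t) (i := (t - i - 1).toNat + 1)
    (by rw [embeddingDegreeLE_f]; push_cast; lia) (not_boundaryGE_embeddingDegreeLE_succ t _)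

/-- The truncation in degrees `≤ t` preserves homology in degrees `≤ t`. -/
def truncDegreeLEHomologyIso {i : ℤ} (hi : i ≤ t) :
    P.homology i ≅ (truncDegreeLE P t).homology i :=
  have := P.quasiIsoAt_πTruncGE (embeddingDegreeLE t) (j := (t - i).toNat) (j' := i)
    (by rw [embeddingDegreeLE_f]; lia)
  isoOfQuasiIsoAt (P.πTruncGE (embeddingDegreeLE t)) i

lemma isZero_homology_of_isZero_X (P : ChainComplex C ℤ) {i : ℤ} (h : IsZero (P.X i)) :
    IsZero (P.homology i) :=
  (h.of_mono (P.iCycles i)).of_epi (P.homologyπ i)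

lemma isSup_truncDegreeLE {P : ChainComplex C ℤ} {t : ℤ} (ht : IsHSup P t) :
    IsSup (truncDegreeLE P t) t :=
  ⟨fun h => ht.1 ((h.of_iso (truncDegreeLEXIsoOpcycles P t).symm).of_mono (P.homologyι t)),
    fun _ hi => isZero_truncDegreeLE_X P t hi⟩

lemma isHSup_truncDegreeLE {P : ChainComplex C ℤ} {t : ℤ} (ht : IsHSup P t) :
    IsHSup (truncDegreeLE P t) t :=
  ⟨fun h => ht.1 (h.of_iso (truncDegreeLEHomologyIso P t le_rfl)),
    fun _ hi => isZero_homology_of_isZero_X _ (isZero_truncDegreeLE_X P t hi)⟩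

lemma isFiniteQuasiProjRes_truncDegreeLE (hproj : ∀ X : C, Projective X → Injective X)
    {M : C} {P : ChainComplex C ℤ} (hP : IsFiniteQuasiProjRes M P) {t : ℤ} (ht : IsHSup P t) :
    IsFiniteQuasiProjRes M (truncDegreeLE P t) where
  projective i := by
    obtain ⟨b, hb⟩ := hP.bddAbove
    rcases lt_trichotomy i t with hi | rfl | hi
    · exact Projective.of_iso (truncDegreeLEXIso P t hi).symm (hP.projective i)
    · exact Projective.of_iso (truncDegreeLEXIsoOpcycles P i).symm
        (projective_opcycles hproj P hP.projective hb ht.2 i le_rfl)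
    · exact (isZero_truncDegreeLE_X P t hi).projective
  bddBelow := by
    obtain ⟨a, ha⟩ := hP.bddBelow
    exact ⟨min a t, fun i hi => (ha i (by lia)).of_iso (truncDegreeLEXIso P t (by lia))⟩
  homology_iso := by
    obtain ⟨m, hm, hiso⟩ := hP.homology_iso
    refine ⟨m, hm, fun j => ?_⟩
    obtain ⟨e⟩ := hiso j
    rcases le_or_gt j t with hj | hj
    · exact ⟨(truncDegreeLEHomologyIso P t hj).symm ≪≫ e⟩
    · exact ⟨((isHSup_truncDegreeLE ht).2 j hj).iso (ht.2 j hj) ≪≫ e⟩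
  bddAbove := ⟨t, fun _ hi => isZero_truncDegreeLE_X P t hi⟩

lemma exists_isFiniteQuasiProjRes_of_qpd_ne_top {M : C} (hM : ¬ IsZero M) (h : qpd M ≠ ⊤) :
    ∃ (P : ChainComplex C ℤ) (t : ℤ), IsFiniteQuasiProjRes M P ∧ IsHSup P t := by
  rw [qpd, if_neg hM] at h
  by_contra! hne
  refine h (sInf_eq_top.2 ?_)
  rintro d ⟨P, s, t, hP, -, ht, -⟩
  exact (hne P t hP ht).elim

/-- In a category where projective objects are injective, the quasi-projective dimension of an
object is either zero or infinite. -/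
lemma qpd_eq_zero_of_ne_top (hproj : ∀ X : C, Projective X → Injective X)
    {M : C} (h : qpd M ≠ ⊤) : qpd M = 0 := by
  by_cases hM : IsZero M
  · rw [qpd, if_pos hM]
  · obtain ⟨P, t, hP, ht⟩ := exists_isFiniteQuasiProjRes_of_qpd_ne_top hM h
    rw [qpd, if_neg hM, ← nonpos_iff_eq_zero]
    exact sInf_le ⟨truncDegreeLE P t, t, t, isFiniteQuasiProjRes_truncDegreeLE hproj hP ht,
      isSup_truncDegreeLE ht, isHSup_truncDegreeLE ht, by simp⟩

end Truncation

section Ext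

/-- Vanishing of `Ext` computed by derived functors implies vanishing of Yoneda `Ext`. -/
lemma subsingleton_ext_of_extIsZero [EnoughProjectives C] [HasExt.{w'} C] {M N : C} {n : ℕ}
    (h : extIsZero M N (n + 1)) : Subsingleton (Abelian.Ext.{w'} M N (n + 1)) := by
  let Q := projectiveResolution M
  refine subsingleton_of_forall_eq 0 fun α => ?_
  obtain ⟨f, hf, rfl⟩ := Q.extMk_surjective α (n + 2) rfl
  rw [Q.extMk_eq_zero_iff f (n + 2) rfl hf n rfl]
  have hz : (Q.complex.linearYonedaObj ℤ N).ExactAt (n + 1) := by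
    rw [HomologicalComplex.exactAt_iff_isZero_homology]
    exact h.of_iso (Q.isoExt (R := ℤ) (n + 1) N).symm
  rw [HomologicalComplex.exactAt_iff' _ n (n + 1) (n + 2) (by simp) (by simp),
    ShortComplex.moduleCat_exact_iff] at hz
  exact hz f hf

variable [HasExt.{w'} C] {M : C} {S : ShortComplex C}

lemma subsingleton_ext_middle (hS : S.ShortExact) {n : ℕ}
    (h₁ : Subsingleton (Abelian.Ext.{w'} M S.X₁ n))
    (h₃ : Subsingleton (Abelian.Ext.{w'} M S.X₃ n)) :
    Subsingleton (Abelian.Ext.{w'} M S.X₂ n) := by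
  refine subsingleton_of_forall_eq 0 fun x => ?_
  obtain ⟨y, rfl⟩ := Ext.covariant_sequence_exact₂ M hS x (Subsingleton.elim _ _)
  rw [Subsingleton.elim y 0, Ext.zero_comp]

lemma subsingleton_ext_right (hS : S.ShortExact) [Injective S.X₂] {n : ℕ}
    (h₁ : Subsingleton (Abelian.Ext.{w'} M S.X₁ (n + 2))) :
    Subsingleton (Abelian.Ext.{w'} M S.X₃ (n + 1)) := by
  refine subsingleton_of_forall_eq 0 fun x => ?_
  obtain ⟨y, rfl⟩ := Ext.covariant_sequence_exact₃ M hS x rfl (Subsingleton.elim _ _)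
  rw [Ext.eq_zero_of_injective y, Ext.zero_comp]

lemma exists_lift_of_subsingleton_ext (hS : S.ShortExact)
    (h₁ : Subsingleton (Abelian.Ext.{w'} M S.X₁ 1)) (φ : M ⟶ S.X₃) :
    ∃ ψ : M ⟶ S.X₂, ψ ≫ S.g = φ := by
  obtain ⟨y, hy⟩ := Ext.covariant_sequence_exact₃ M hS (Ext.mk₀ φ) rfl (Subsingleton.elim _ _)
  obtain ⟨ψ, rfl⟩ := (Ext.mk₀_bijective M S.X₂).2 y
  rw [Ext.mk₀_comp_mk₀] at hy
  exact ⟨ψ, (Ext.mk₀_bijective M S.X₃).1 hy⟩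

lemma subsingleton_ext_of_iso_copies {N H : C} {k n : ℕ} (e : H ≅ copies N k)
    (h : Subsingleton (Abelian.Ext.{w'} M N n)) : Subsingleton (Abelian.Ext.{w'} M H n) := by
  have hc : Subsingleton (Abelian.Ext.{w'} M (copies N k) n) :=
    (Ext.addEquivBiproduct M (biproduct.isBilimit fun _ : Fin k => N) n).injective.subsingleton
  refine subsingleton_of_forall_eq 0 fun x => ?_
  have hx : x = (x.comp (Ext.mk₀ e.hom) (add_zero n)).comp (Ext.mk₀ e.inv) (add_zero n) := by
    simp
  rw [hx, Subsingleton.elim (x.comp (Ext.mk₀ e.hom) (add_zero n)) 0, Ext.zero_comp]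

end Ext

section Cycles

variable (P : ChainComplex C ℤ)

/-- The short exact sequence of boundaries, cycles and homology. -/
lemma shortExact_boundaries_cycles_homology (i : ℤ) :
    (ShortComplex.mk (kernel.ι (P.homologyπ i)) (P.homologyπ i)
      (kernel.condition _)).ShortExact where
  exact := ShortComplex.exact_kernel _
  mono_f := inferInstanceAs (Mono (kernel.ι (P.homologyπ i)))
  epi_g := inferInstanceAs (Epi (P.homologyπ i))

/-- The differential of a complex, corestricted to the boundaries. -/
def toBoundaries (i : ℤ) : P.X (i + 1) ⟶ kernel (P.homologyπ i) :=
  kernel.lift _ (P.toCycles (i + 1) i) (by simp)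

@[simp]
lemma toBoundaries_ι (i : ℤ) :
    toBoundaries P i ≫ kernel.ι (P.homologyπ i) = P.toCycles (i + 1) i :=
  kernel.lift_ι _ _ _

lemma iCycles_toBoundaries (i : ℤ) : P.iCycles (i + 1) ≫ toBoundaries P i = 0 := by
  simp [← cancel_mono (kernel.ι (P.homologyπ i)), ← cancel_mono (P.iCycles i)]

/-- The short exact sequence of cycles, chains and boundaries. -/
lemma shortExact_cycles_X_boundaries (i : ℤ) :
    (ShortComplex.mk (P.iCycles (i + 1)) (toBoundaries P i)
      (iCycles_toBoundaries P i)).ShortExact := by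
  have hij : (ComplexShape.down ℤ).Rel (i + 1) i := rfl
  let S := ShortComplex.mk (P.iCycles (i + 1)) (toBoundaries P i) (iCycles_toBoundaries P i)
  let T := ShortComplex.mk (P.iCycles (i + 1)) (P.d (i + 1) i) (by simp)
  let ι : S ⟶ T :=
    { τ₁ := 𝟙 _, τ₂ := 𝟙 _, τ₃ := kernel.ι (P.homologyπ i) ≫ P.iCycles i
      comm₂₃ := by simp [S, T, reassoc_of% (toBoundaries_ι P i)] }
  have hT : T.Exact :=
    T.exact_of_f_is_kernel (P.cyclesIsKernel (i + 1) i (ComplexShape.next_eq' _ hij))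
  have : Mono ι.τ₃ := inferInstanceAs (Mono (kernel.ι (P.homologyπ i) ≫ P.iCycles i))
  have hepi : Epi (toBoundaries P i) :=
    (ShortComplex.exact_of_g_is_cokernel
      (ShortComplex.mk _ _ (P.toCycles_comp_homologyπ (i + 1) i))
      (P.homologyIsCokernel (i + 1) i (ComplexShape.prev_eq' _ hij))).epi_kernelLift
  exact
    { exact := (ShortComplex.exact_iff_of_epi_of_isIso_of_mono ι).2 hT
      mono_f := inferInstanceAs (Mono (P.iCycles (i + 1)))
      epi_g := hepi }

variable {P}

/-- The cycles of a bounded-below complex of projectives are projective in all degrees below which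
the complex is acyclic. -/
lemma projective_cycles (hP : ∀ i, Projective (P.X i)) {a : ℤ}
    (ha : ∀ i, i < a → IsZero (P.X i)) {t : ℤ} (ht : ∀ i, i < t → IsZero (P.homology i))
    (i : ℤ) (hi : i ≤ t) : Projective (P.cycles i) := by
  have key : ∀ (n : ℕ) (i : ℤ), i ≤ t → i < a + n → Projective (P.cycles i) := by
    intro n
    induction n with
    | zero =>
      intro i _ hai
      exact ((ha i (by simpa using hai)).of_mono (P.iCycles i)).projective
    | succ n ih =>
      intro i hti hai
      obtain ⟨j, rfl⟩ : ∃ j, i = j + 1 := ⟨i - 1, by lia⟩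
      have hj : Projective (P.cycles j) := ih j (by lia) (by push_cast at hai; lia)
      have hiso : IsIso (kernel.ι (P.homologyπ j)) :=
        (shortExact_boundaries_cycles_homology P j).isIso_f_iff.2 (ht j (by lia))
      have hB : Projective (kernel (P.homologyπ j)) :=
        Projective.of_iso (asIso (kernel.ι (P.homologyπ j))).symm hj
      let σ := (shortExact_cycles_X_boundaries P j).splittingOfProjective
      have := hP (j + 1)
      exact Retract.projective (Y := P.X (j + 1)) ⟨P.iCycles (j + 1), σ.r, σ.f_r⟩
  exact key (i + 1 - a).toNat i hi (by lia)

/-- If all terms of a bounded-above complex are injective and `Ext^i(M, -)` vanishes on its homology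
for `i ≥ 2`, then `Ext^i(M, -)` vanishes on its boundaries for `i ≥ 1`. -/
lemma subsingleton_ext_boundaries [HasExt.{w'} C] {M : C} (hP : ∀ i, Injective (P.X i))
    {b : ℤ} (hb : ∀ i, b < i → IsZero (P.X i))
    (hH : ∀ i n, Subsingleton (Abelian.Ext.{w'} M (P.homology i) (n + 2))) (i : ℤ) (n : ℕ) :
    Subsingleton (Abelian.Ext.{w'} M (kernel (P.homologyπ i)) (n + 1)) := by
  have key : ∀ (m : ℕ) (i : ℤ), b < i + m → ∀ n : ℕ,
      Subsingleton (Abelian.Ext.{w'} M (kernel (P.homologyπ i)) (n + 1)) := by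
    intro m
    induction m with
    | zero =>
      intro i hbi n
      have : Injective (kernel (P.homologyπ i)) := (((hb i (by simpa using hbi)).of_mono
        (P.iCycles i)).of_mono (kernel.ι (P.homologyπ i))).injective
      exact Ext.subsingleton_of_injective _ _ n
    | succ m ih =>
      intro i hbi n
      have := hP (i + 1)
      exact subsingleton_ext_right (shortExact_cycles_X_boundaries P i)
        (subsingleton_ext_middle (shortExact_boundaries_cycles_homology P (i + 1))
          (ih (i + 1) (by push_cast at hbi; lia) (n + 1)) (hH (i + 1) n))
  exact key (b + 1 - i).toNat i (by lia) n

end Cycles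

/-- A nonempty direct sum of copies of `M` has `M` as a retract. -/
def retractCopies (M : C) {k : ℕ} (hk : k ≠ 0) : Retract M (copies M k) where
  i := biproduct.ι (fun _ : Fin k => M) ⟨0, Nat.pos_of_ne_zero hk⟩
  r := biproduct.π (fun _ : Fin k => M) ⟨0, Nat.pos_of_ne_zero hk⟩
  retract := biproduct.ι_π_self _ _

lemma isZero_copies_zero (M : C) : IsZero (copies M 0) := by
  rw [IsZero.iff_id_eq_zero]
  exact biproduct.hom_ext _ _ fun j => j.elim0

/-- In a category where projective objects are injective, an object with a finite quasi-projective
resolution and no self-extensions of degree at least `2` is projective. -/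
lemma projective_of_isFiniteQuasiProjRes [HasExt.{w'} C]
    (hproj : ∀ X : C, Projective X → Injective X) {M : C} {P : ChainComplex C ℤ}
    (hP : IsFiniteQuasiProjRes M P)
    (hM : ∀ n : ℕ, Subsingleton (Abelian.Ext.{w'} M M (n + 2))) : Projective M := by
  by_cases hM0 : IsZero M
  · exact hM0.projective
  obtain ⟨a, ha⟩ := hP.bddBelow
  obtain ⟨b, hb⟩ := hP.bddAbove
  obtain ⟨m, hm, hiso⟩ := hP.homology_iso
  have hbdd : ∀ i, m i ≠ 0 → a ≤ i := by
    intro i hi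
    by_contra! hia
    obtain ⟨e⟩ := hiso i
    exact hM0 (((isZero_homology_of_isZero_X P (ha i hia)).of_iso e.symm).of_mono
      (retractCopies M hi).i)
  obtain ⟨t, hmt, ht⟩ := Int.exists_least_of_bdd ⟨a, hbdd⟩ hm
  have hacyclic : ∀ i, i < t → IsZero (P.homology i) := by
    intro i hi
    obtain ⟨e⟩ := hiso i
    have hmi : m i = 0 := by
      by_contra h
      exact absurd (ht i h) (by lia)
    rw [hmi] at e
    exact (isZero_copies_zero M).of_iso e
  have hB := subsingleton_ext_boundaries (M := M) (P := P)
    (fun i => hproj _ (hP.projective i)) hb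
    (fun i n => subsingleton_ext_of_iso_copies (hiso i).some (hM n)) t 0
  obtain ⟨e⟩ := hiso t
  let ρ := retractCopies M hmt
  obtain ⟨ψ, hψ⟩ := exists_lift_of_subsingleton_ext
    (shortExact_boundaries_cycles_homology P t) hB (ρ.i ≫ e.inv)
  dsimp at ψ hψ
  have := projective_cycles hP.projective ha hacyclic t le_rfl
  exact Retract.projective (Y := P.cycles t)
    ⟨ψ, P.homologyπ t ≫ e.hom ≫ ρ.r, by simp [reassoc_of% hψ]⟩

end QPD

end

open QPD in
/-- For a quasi-Frobenius ring `R`, `qgldim R` is `0` or `∞`; and if it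
is `0`, then every finitely generated module `M` with `Ext^i(M, M) = 0` for all `i ≥ 2` is
projective. -/
theorem qgldim_eq_zero_or_top_of_quasiFrobenius {R : Type u} [Ring R]
    (hQF : ∀ M : ModuleCat.{u} R, Projective M ↔ Injective M) :
    (qgldim R = 0 ∨ qgldim R = ⊤) ∧
    (qgldim R = 0 → ∀ M : ModuleCat.{u} R, Module.Finite R M →
      (∀ i : ℕ, 2 ≤ i → extIsZero M M i) → Projective M) := by
  have hproj : ∀ X : ModuleCat.{u} R, Projective X → Injective X := fun X => (hQF X).1
  refine ⟨?_, fun h0 M hMfin hExt => ?_⟩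
  · by_cases h : ∃ M : ModuleCat.{u} R, Module.Finite R M ∧ qpd M = ⊤
    · obtain ⟨M, hMfin, hM⟩ := h
      exact Or.inr (top_le_iff.1 (le_sSup ⟨M, hMfin, hM.symm⟩))
    · push Not at h
      refine Or.inl (nonpos_iff_eq_zero.1 (sSup_le ?_))
      rintro d ⟨M, hMfin, rfl⟩
      exact (qpd_eq_zero_of_ne_top hproj (h M hMfin)).le
  · by_cases hM0 : IsZero M
    · exact hM0.projective
    have hqpd : qpd M ≤ qgldim R := le_sSup ⟨M, hMfin, rfl⟩
    rw [h0] at hqpd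
    obtain ⟨P, t, hP, -⟩ := exists_isFiniteQuasiProjRes_of_qpd_ne_top hM0
      (ne_top_of_le_ne_top ENat.zero_ne_top hqpd)
    have := HasExt.standard (ModuleCat.{u} R)
    exact projective_of_isFiniteQuasiProjRes hproj hP
      fun n => subsingleton_ext_of_extIsZero (hExt (n + 2) (by lia))
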